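/- (Liouville theorem under (H1) and (H3).) Let N ≥ 1 and let f satisfy (H1) and (H3). Then every bounded nonnegative C² solution u of Δu + f(u) = 0 in ℝ^N is constant. -/

import Mathlib

open Set Filter

noncomputable section

/-- Partial derivative of `u` in the `i`-th coordinate direction. -/
def pd {N : ℕ} (i : Fin N) (u : (Fin N → ℝ) → ℝ) (x : Fin N → ℝ) : ℝ :=
  deriv (fun t => u (Function.update x i t)) (x i)

/-- Laplace operator: the sum of the pure second partial derivatives. -/
def lap {N : ℕ} (u : (Fin N → ℝ) → ℝ) (x : Fin N → ℝ) : ℝ :=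
  ∑ i, pd i (pd i u) x

/-- `f` is locally Lipschitz-continuous on `[0, +∞)`. -/
def LocLipOn (f : ℝ → ℝ) : Prop :=
  ∀ b : ℝ, ∃ L : NNReal, LipschitzOnWith L f (Set.Icc 0 b)

/-- Hypothesis (H1): `f` is locally Lipschitz on `[0,∞)`, positive on `(0,μ)`, nonpositive on
`[μ,∞)`, nonincreasing on `[μ',μ]`, and either `f(0) > 0` or `f(0) = 0` with
`liminf_{s→0⁺} f(s)/s > 0`. -/
def H1 (f : ℝ → ℝ) (μ' μ : ℝ) : Prop :=
  LocLipOn f ∧ 0 < μ' ∧ μ' < μ ∧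
  (∀ s, 0 < s → s < μ → 0 < f s) ∧
  (∀ s, μ ≤ s → f s ≤ 0) ∧
  (∀ s t, μ' ≤ s → s ≤ t → t ≤ μ → f t ≤ f s) ∧
  (0 < f 0 ∨ (f 0 = 0 ∧ ∃ c > 0, ∀ᶠ s in nhdsWithin (0:ℝ) (Set.Ioi 0), c ≤ f s / s))

/-- Hypothesis (H2): `f` is locally Lipschitz and nonnegative on `[0,∞)`, and at every
nonnegative zero `z` of `f`, `liminf_{s→z⁺} f(s)/(s-z) > 0`. -/
def H2 (f : ℝ → ℝ) : Prop :=
  LocLipOn f ∧ (∀ s, 0 ≤ s → 0 ≤ f s) ∧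
  (∀ z, 0 ≤ z → f z = 0 → ∃ c > 0, ∀ᶠ s in nhdsWithin z (Set.Ioi z), c ≤ f s / (s - z))

/-- Hypothesis (H3): `liminf_{s→z⁻} f(s)/(s-z) > 0` for every zero `z > μ` of `f`. -/
def H3 (f : ℝ → ℝ) (μ : ℝ) : Prop :=
  ∀ z, μ < z → f z = 0 → ∃ c > 0, ∀ᶠ s in nhdsWithin z (Set.Iio z), c ≤ f s / (s - z)

/-- `(V, V')` is a `C²` solution on `[0,+∞)` of `V'' + f(V) = 0` with `V(0) = 0`,
`0 < V < z` on `(0,+∞)` and `V(+∞) = z` (the one-dimensional profile `V_z`). -/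
def IsProfile (f : ℝ → ℝ) (z : ℝ) (V V' : ℝ → ℝ) : Prop :=
  (∀ ξ ∈ Set.Ici (0:ℝ), HasDerivWithinAt V (V' ξ) (Set.Ici 0) ξ) ∧
  (∀ ξ ∈ Set.Ici (0:ℝ), HasDerivWithinAt V' (-(f (V ξ))) (Set.Ici 0) ξ) ∧
  V 0 = 0 ∧ (∀ ξ, 0 < ξ → 0 < V ξ ∧ V ξ < z) ∧
  Filter.Tendsto V Filter.atTop (nhds z)

/-- The translates `x ↦ u(x + h e₁)` converge as `h → +∞`, uniformly on `K` together with all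
partial derivatives up to order two, to the limits `w`, `w1 i`, `w2 i j`. -/
def C2ConvOn {N : ℕ} (i0 : Fin N) (u : (Fin N → ℝ) → ℝ) (K : Set (Fin N → ℝ))
    (w : (Fin N → ℝ) → ℝ) (w1 : Fin N → (Fin N → ℝ) → ℝ)
    (w2 : Fin N → Fin N → (Fin N → ℝ) → ℝ) : Prop :=
  TendstoUniformlyOn (fun (h : ℝ) x => u (Function.update x i0 (x i0 + h))) w
    Filter.atTop K ∧
  (∀ i, TendstoUniformlyOn (fun (h : ℝ) x => pd i u (Function.update x i0 (x i0 + h)))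
      (w1 i) Filter.atTop K) ∧
  (∀ i j, TendstoUniformlyOn
      (fun (h : ℝ) x => pd i (pd j u) (Function.update x i0 (x i0 + h)))
      (w2 i j) Filter.atTop K)

/-- `F(z) = ∫₀^z f(σ) dσ`. -/
def Ff (f : ℝ → ℝ) (z : ℝ) : ℝ := ∫ σ in (0:ℝ)..z, f σ

/-- The set `Z_f = {z₀ ≥ 0 : f(z₀) = 0 and F(z) < F(z₀) for all z ∈ [0,z₀)}`. -/
def Zf (f : ℝ → ℝ) : Set ℝ :=
  {z | 0 ≤ z ∧ f z = 0 ∧ ∀ w, 0 ≤ w → w < z → Ff f w < Ff f z}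

/-- `(V, V')` belongs to `R_f`: a bounded nonnegative `C²` solution on `[0,∞)` of
`V'' + f(V) = 0` with `V(0) = 0`. -/
def InRf (f V V' : ℝ → ℝ) : Prop :=
  (∀ ξ ∈ Set.Ici (0:ℝ), HasDerivWithinAt V (V' ξ) (Set.Ici 0) ξ) ∧
  (∀ ξ ∈ Set.Ici (0:ℝ), HasDerivWithinAt V' (-(f (V ξ))) (Set.Ici 0) ξ) ∧
  V 0 = 0 ∧ (∀ ξ, 0 ≤ ξ → 0 ≤ V ξ) ∧ (∃ C, ∀ ξ, 0 ≤ ξ → V ξ ≤ C)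

theorem deriv_deriv_nonneg_of_isLocalMin {g : ℝ → ℝ} {t : ℝ} (hg : ContDiff ℝ 2 g)
    (h : IsLocalMin g t) : 0 ≤ deriv (deriv g) t := by
  by_contra! hneg
  have hmax : IsLocalMax g t :=
    isLocalMax_of_deriv_deriv_neg hneg h.deriv_eq_zero hg.continuous.continuousAt
  have hconst : g =ᶠ[nhds t] fun _ => g t := by
    filter_upwards [h, hmax] with s h1 h2 using le_antisymm h2 h1
  have : deriv (deriv g) t = 0 := by
    rw [hconst.deriv.deriv_eq]
    simp
  linarith

theorem pd_pd_eq {N : ℕ} (i : Fin N) (u : (Fin N → ℝ) → ℝ) (x : Fin N → ℝ) :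
    pd i (pd i u) x = deriv (deriv fun t => u (Function.update x i t)) (x i) := by
  simp [pd]

/-- If `w - φ` has a local minimum at `x`, then `Δφ ≤ Δw` there. -/
theorem lap_le_lap_of_isLocalMin {N : ℕ} {w φ : (Fin N → ℝ) → ℝ} {x : Fin N → ℝ}
    (hw : ContDiff ℝ 2 w) (hφ : ContDiff ℝ 2 φ) (h : IsLocalMin (fun y => w y - φ y) x) :
    lap φ x ≤ lap w x := by
  refine Finset.sum_le_sum fun i _ => ?_
  have hup : ContDiff ℝ 2 (Function.update x i) := contDiff_update 2 x i
  have hW : ContDiff ℝ 2 fun t => w (Function.update x i t) := hw.comp hup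
  have hΦ : ContDiff ℝ 2 fun t => φ (Function.update x i t) := hφ.comp hup
  have hmin : IsLocalMin
      (fun t => w (Function.update x i t) - φ (Function.update x i t)) (x i) := by
    have hx : Function.update x i (x i) = x := Function.update_eq_self i x
    have ht : Tendsto (Function.update x i) (nhds (x i)) (nhds x) := by
      have := hup.continuous.tendsto (x i)
      rwa [hx] at this
    have hev := ht.eventually h
    filter_upwards [hev] with t h1
    simpa using h1
  have key := deriv_deriv_nonneg_of_isLocalMin (hW.sub hΦ) hmin
  have hd : deriv (fun t => w (Function.update x i t) - φ (Function.update x i t)) =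
      fun t => deriv (fun t => w (Function.update x i t)) t -
        deriv (fun t => φ (Function.update x i t)) t := by
    funext t
    exact deriv_fun_sub (hW.differentiable (by norm_num) t) (hΦ.differentiable (by norm_num) t)
  have hdd (g : ℝ → ℝ) (hg : ContDiff ℝ 2 g) : Differentiable ℝ (deriv g) :=
    ((contDiff_succ_iff_deriv (n := 1)).1 hg).2.2.differentiable (by norm_num)
  rw [hd, deriv_fun_sub (hdd _ hW _) (hdd _ hΦ _)] at key
  rw [pd_pd_eq, pd_pd_eq]
  linarith

theorem lap_const_mul {N : ℕ} (t : ℝ) (u : (Fin N → ℝ) → ℝ) (x : Fin N → ℝ) :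
    lap (fun y => t * u y) x = t * lap u x := by
  have h (i : Fin N) (v : (Fin N → ℝ) → ℝ) : pd i (fun y => t * v y) = fun y => t * pd i v y :=
    funext fun y => deriv_const_mul_field t
  simp only [lap, h, Finset.mul_sum]

/-- The squared Euclidean distance to `y`. -/
def sqDist {N : ℕ} (y x : Fin N → ℝ) : ℝ := ∑ i, (x i - y i) ^ 2

theorem contDiff_sqDist {N : ℕ} (y : Fin N → ℝ) : ContDiff ℝ 2 (sqDist y) := by
  unfold sqDist
  fun_prop

theorem sqDist_nonneg {N : ℕ} (y x : Fin N → ℝ) : 0 ≤ sqDist y x :=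
  Finset.sum_nonneg fun _ _ => sq_nonneg _

theorem sqDist_self {N : ℕ} (y : Fin N → ℝ) : sqDist y y = 0 := by simp [sqDist]

theorem dist_le_of_sqDist_le {N : ℕ} {y x : Fin N → ℝ} {r : ℝ} (hr : 0 ≤ r)
    (h : sqDist y x ≤ r ^ 2) : dist x y ≤ r := by
  refine (dist_pi_le_iff hr).2 fun i => ?_
  rw [Real.dist_eq]
  refine abs_le_of_sq_le_sq (le_trans ?_ h) hr
  exact Finset.single_le_sum (f := fun i => (x i - y i) ^ 2) (fun _ _ => sq_nonneg _)
    (Finset.mem_univ i)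

theorem isCompact_sqDist_le {N : ℕ} (y : Fin N → ℝ) (A : ℝ) :
    IsCompact {x | sqDist y x ≤ A} := by
  refine (isCompact_closedBall y √(max A 0)).of_isClosed_subset
    (isClosed_le (contDiff_sqDist y).continuous continuous_const) fun x hx => ?_
  refine dist_le_of_sqDist_le (Real.sqrt_nonneg _) ?_
  rw [Real.sq_sqrt (le_max_right _ _)]
  exact le_trans hx (le_max_left _ _)

/-- The Gaussian bump around `y`, shifted so as to vanish where `sqDist y = A`. -/
def bump {N : ℕ} (a A : ℝ) (y x : Fin N → ℝ) : ℝ :=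
  Real.exp (-a * sqDist y x) - Real.exp (-a * A)

theorem contDiff_bump {N : ℕ} (a A : ℝ) (y : Fin N → ℝ) : ContDiff ℝ 2 (bump a A y) :=
  (((contDiff_const.mul (contDiff_sqDist y)).exp).sub contDiff_const)

theorem bump_pos_iff {N : ℕ} {a A : ℝ} (ha : 0 < a) {y x : Fin N → ℝ} :
    0 < bump a A y x ↔ sqDist y x < A := by
  simp only [bump, sub_pos, Real.exp_lt_exp, neg_mul, neg_lt_neg_iff]
  exact mul_lt_mul_iff_right₀ ha

theorem hasDerivAt_sqDist_update {N : ℕ} (y x : Fin N → ℝ) (i : Fin N) (t : ℝ) :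
    HasDerivAt (fun t => sqDist y (Function.update x i t)) (2 * (t - y i)) t := by
  have h : (fun t => sqDist y (Function.update x i t)) =
      fun t => (t - y i) ^ 2 + ∑ j ∈ Finset.univ.erase i, (x j - y j) ^ 2 := by
    funext t
    rw [sqDist, ← Finset.add_sum_erase _ _ (Finset.mem_univ i)]
    congr 1
    · simp
    · exact Finset.sum_congr rfl fun j hj => by
        rw [Function.update_of_ne (Finset.ne_of_mem_erase hj)]
  rw [h]
  refine HasDerivAt.add_const _ ?_
  simpa using ((hasDerivAt_id t).sub_const (y i)).fun_pow 2

theorem lap_bump {N : ℕ} (a A : ℝ) (y x : Fin N → ℝ) :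
    lap (bump a A y) x =
      (4 * a ^ 2 * sqDist y x - 2 * a * N) * Real.exp (-a * sqDist y x) := by
  have h (i : Fin N) : pd i (pd i (bump a A y)) x =
      (4 * a ^ 2 * (x i - y i) ^ 2 - 2 * a) * Real.exp (-a * sqDist y x) := by
    rw [pd_pd_eq]
    have hexp (t : ℝ) : HasDerivAt (fun t => Real.exp (-a * sqDist y (Function.update x i t)))
        (Real.exp (-a * sqDist y (Function.update x i t)) * (-a * (2 * (t - y i)))) t :=
      ((hasDerivAt_sqDist_update y x i t).const_mul (-a)).exp
    have h1 : deriv (fun t => bump a A y (Function.update x i t)) = fun t =>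
        Real.exp (-a * sqDist y (Function.update x i t)) * (-a * (2 * (t - y i))) :=
      funext fun t => ((hexp t).sub_const _).deriv
    have h2 := (hexp (x i)).mul
      ((((hasDerivAt_id (x i)).sub_const (y i)).const_mul 2).const_mul (-a))
    rw [h1]
    refine h2.deriv.trans ?_
    simp only [Function.update_eq_self, id]
    ring
  simp only [lap, h, ← Finset.sum_mul, Finset.sum_sub_distrib, ← Finset.mul_sum]
  simp [sqDist]
  ring

/-- Strong maximum principle: a nonnegative function that is superharmonic where it is small
is positive everywhere once it is positive somewhere. -/
theorem pos_of_pos_of_lap_nonpos {N : ℕ} {w : (Fin N → ℝ) → ℝ} {δ : ℝ} (hδ : 0 < δ)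
    (hw : ContDiff ℝ 2 w) (hw0 : ∀ x, 0 ≤ w x) (hlap : ∀ x, w x < δ → lap w x ≤ 0)
    {x₀ : Fin N → ℝ} (hx₀ : 0 < w x₀) (z : Fin N → ℝ) : 0 < w z := by
  obtain ⟨r, hr, hball⟩ : ∃ r > 0, ∀ x, dist x x₀ < r → w x₀ / 2 < w x :=
    Metric.eventually_nhds_iff.1
      (hw.continuous.continuousAt.eventually (lt_mem_nhds (half_lt_self hx₀)))
  have hrs : 0 < (r / 2) ^ 2 := by positivity
  set a : ℝ := (N + 1) / (r / 2) ^ 2 with ha_def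
  have ha : 0 < a := by positivity
  have har : a * (r / 2) ^ 2 = N + 1 := by rw [ha_def]; field_simp
  set A := sqDist x₀ z + 1 with hA
  set t := min (w x₀ / 2) (δ / 2)
  have ht : 0 < t := lt_min (by positivity) (by positivity)
  have htφ : ContDiff ℝ 2 fun x => t * bump a A x₀ x := contDiff_const.mul (contDiff_bump _ _ _)
  have hzA : sqDist x₀ z < A := by linarith
  obtain ⟨x₁, hx₁, hmin⟩ := (isCompact_sqDist_le x₀ A).exists_isMinOn ⟨z, hzA.le⟩
    (hw.sub htφ).continuous.continuousOn
  rcases le_or_gt 0 (w x₁ - t * bump a A x₀ x₁) with h | h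
  · have h1 : w x₁ - t * bump a A x₀ x₁ ≤ w z - t * bump a A x₀ z := hmin hzA.le
    have h2 := mul_pos ht ((bump_pos_iff ha).2 hzA)
    linarith
  exfalso
  have hb : 0 < bump a A x₀ x₁ := by
    by_contra! hb
    nlinarith [hw0 x₁]
  have hb1 : bump a A x₀ x₁ ≤ 1 := by
    have h1 : Real.exp (-a * sqDist x₀ x₁) ≤ 1 := by
      rw [Real.exp_le_one_iff]
      nlinarith [sqDist_nonneg x₀ x₁]
    have h2 := Real.exp_pos (-a * A)
    unfold bump
    linarith
  have hwt : w x₁ < t := by nlinarith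
  have hq : (r / 2) ^ 2 < sqDist x₀ x₁ := by
    by_contra! hq
    have := hball x₁ (lt_of_le_of_lt (dist_le_of_sqDist_le (by positivity) hq) (by linarith))
    exact absurd (min_le_left (w x₀ / 2) (δ / 2)) (not_le.2 (this.trans hwt))
  have hloc : IsLocalMin (fun x => w x - t * bump a A x₀ x) x₁ := by
    refine hmin.isLocalMin (Filter.mem_of_superset ?_ fun x (hx : sqDist x₀ x < A) => hx.le)
    exact (isOpen_lt (contDiff_sqDist x₀).continuous continuous_const).mem_nhds
      ((bump_pos_iff ha).1 hb)
  have hle := lap_le_lap_of_isLocalMin hw htφ hloc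
  have hlapφ : 0 < lap (fun x => t * bump a A x₀ x) x₁ := by
    rw [lap_const_mul, lap_bump]
    have : (N : ℝ) + 1 < a * sqDist x₀ x₁ := har ▸ mul_lt_mul_of_pos_left hq ha
    refine mul_pos ht (mul_pos ?_ (Real.exp_pos _))
    have hN : (0 : ℝ) ≤ N := Nat.cast_nonneg N
    nlinarith
  have := hlap x₁ (hwt.trans_le ((min_le_right _ _).trans (half_le_self hδ.le)))
  linarith

/-- A positive function with `Δw ≤ -c w` wherever `w < δ` is bounded below by `δ`. -/
theorem le_of_pos_of_lap_le {N : ℕ} {w : (Fin N → ℝ) → ℝ} {c δ : ℝ} (hc : 0 < c)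
    (hw : ContDiff ℝ 2 w) (hpos : ∀ x, 0 < w x) (hlap : ∀ x, w x < δ → lap w x ≤ -c * w x)
    (y : Fin N → ℝ) : δ ≤ w y := by
  by_contra! hy
  have hN : (0 : ℝ) ≤ N := Nat.cast_nonneg N
  set a : ℝ := c / (4 * (N + 1)) with ha_def
  have ha : 0 < a := by positivity
  have haN : 4 * a * (N + 1) = c := by rw [ha_def]; field_simp
  set A : ℝ := (N / 2 + 1) / a with hA_def
  have hA : 0 < A := by positivity
  have haA : a * A = N / 2 + 1 := by rw [hA_def]; field_simp
  have hyA : sqDist y y < A := by rwa [sqDist_self]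
  obtain ⟨x₁, hx₁, hmax⟩ := (isCompact_sqDist_le y A).exists_isMaxOn ⟨y, hyA.le⟩
    ((contDiff_bump a A y).continuous.div hw.continuous fun x => (hpos x).ne').continuousOn
  have hby : 0 < bump a A y y := (bump_pos_iff ha).2 hyA
  have hmaxy : bump a A y y / w y ≤ bump a A y x₁ / w x₁ := hmax hyA.le
  have hb : 0 < bump a A y x₁ := by
    have := (div_pos hby (hpos y)).trans_le hmaxy
    exact (div_pos_iff_of_pos_right (hpos x₁)).1 this
  set t := w x₁ / bump a A y x₁ with ht_def
  have ht : 0 < t := div_pos (hpos _) hb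
  have htx : t * bump a A y x₁ = w x₁ := div_mul_cancel₀ _ hb.ne'
  have hcomp : ∀ x, sqDist y x ≤ A → t * bump a A y x ≤ w x := fun x hx => by
    have h1 : bump a A y x / w x ≤ bump a A y x₁ / w x₁ := hmax hx
    rw [div_le_div_iff₀ (hpos _) (hpos _), ← htx] at h1
    refine le_of_mul_le_mul_right ?_ hb
    linarith
  have hbmax : bump a A y x₁ ≤ bump a A y y := by
    refine sub_le_sub_right (Real.exp_le_exp.2 ?_) _
    rw [sqDist_self]
    nlinarith [sqDist_nonneg y x₁]
  have hwx : w x₁ < δ := by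
    calc w x₁ = t * bump a A y x₁ := htx.symm
      _ ≤ t * bump a A y y := by gcongr
      _ ≤ w y := hcomp y hyA.le
      _ < δ := hy
  have htφ : ContDiff ℝ 2 fun x => t * bump a A y x := contDiff_const.mul (contDiff_bump _ _ _)
  have hqA := (bump_pos_iff ha).1 hb
  have hloc : IsLocalMin (fun x => w x - t * bump a A y x) x₁ := by
    filter_upwards [(isOpen_lt (contDiff_sqDist y).continuous continuous_const).mem_nhds hqA]
      with x hx
    have := hcomp x (le_of_lt hx)
    linarith
  have hle := lap_le_lap_of_isLocalMin hw htφ hloc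
  have hlapφ : -c * bump a A y x₁ < lap (bump a A y) x₁ := by
    rw [lap_bump]
    have hE : 0 < Real.exp (-a * sqDist y x₁) := Real.exp_pos _
    have hcb : 0 < c * bump a A y x₁ := mul_pos hc hb
    rcases le_or_gt ((N : ℝ) / 2) (a * sqDist y x₁) with hq | hq
    · have : 0 ≤ 4 * a ^ 2 * sqDist y x₁ - 2 * a * N := by nlinarith
      nlinarith [mul_nonneg this hE.le]
    · have h2 : 2 * Real.exp (-a * A) < Real.exp (-a * sqDist y x₁) := by
        have he : (2 : ℝ) < Real.exp 1 := by linarith [Real.exp_one_gt_d9]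
        calc 2 * Real.exp (-a * A) < Real.exp 1 * Real.exp (-a * A) := by
              gcongr
          _ = Real.exp (1 + -a * A) := (Real.exp_add _ _).symm
          _ ≤ _ := Real.exp_le_exp.2 (by linarith)
      have h3 : 0 ≤ 4 * a ^ 2 * sqDist y x₁ * Real.exp (-a * sqDist y x₁) := by
        have := sqDist_nonneg y x₁
        positivity
      have h4 : 2 * a * N ≤ c / 2 := by linarith
      have h5 := mul_le_mul_of_nonneg_right h4 hE.le
      have h6 := mul_lt_mul_of_pos_left h2 hc
      unfold bump
      linarith
  have := hlap x₁ hwx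
  rw [lap_const_mul] at hle
  have := mul_lt_mul_of_pos_left hlapφ ht
  have h8 : t * (-c * bump a A y x₁) = -c * w x₁ := by rw [← htx]; ring
  linarith

theorem eq_zero_or_le_of_lap_le {N : ℕ} {w : (Fin N → ℝ) → ℝ} {c δ : ℝ} (hc : 0 < c)
    (hδ : 0 < δ) (hw : ContDiff ℝ 2 w) (hw0 : ∀ x, 0 ≤ w x)
    (hlap : ∀ x, w x < δ → lap w x ≤ -c * w x) : (∀ x, w x = 0) ∨ ∀ x, δ ≤ w x := by
  by_cases h : ∀ x, w x = 0
  · exact Or.inl h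
  push Not at h
  obtain ⟨x₀, hx₀⟩ := h
  refine Or.inr (le_of_pos_of_lap_le hc hw (fun z => ?_) hlap)
  refine pos_of_pos_of_lap_nonpos hδ hw hw0 (fun x hx => ?_) ((hw0 x₀).lt_of_ne' hx₀) z
  have := hlap x hx
  nlinarith [hw0 x]

theorem lap_sub_const {N : ℕ} (u : (Fin N → ℝ) → ℝ) (m : ℝ) (x : Fin N → ℝ) :
    lap (fun y => u y - m) x = lap u x := by
  have h (i : Fin N) : pd i (fun y => u y - m) = pd i u :=
    funext fun y => by simp [pd]
  simp [lap, h]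

theorem lap_const_sub {N : ℕ} (u : (Fin N → ℝ) → ℝ) (M : ℝ) (x : Fin N → ℝ) :
    lap (fun y => M - u y) x = -lap u x := by
  have h (i : Fin N) : pd i (fun y => M - u y) = fun y => -pd i u y :=
    funext fun y => by simp [pd]
  have h' (i : Fin N) : pd i (fun y => -pd i u y) x = -pd i (pd i u) x :=
    deriv.fun_neg
  simp [lap, h, h']

theorem LocLipOn.continuousWithinAt {f : ℝ → ℝ} (hf : LocLipOn f) {s : ℝ} (hs : 0 ≤ s) :
    ContinuousWithinAt f (Ici 0) s := by
  obtain ⟨L, hL⟩ := hf (s + 1)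
  refine (hL.continuousOn s ⟨hs, by linarith⟩).mono_of_mem_nhdsWithin ?_
  rw [← Ici_inter_Iic]
  exact inter_mem_nhdsWithin _ (Iic_mem_nhds (by linarith))

theorem H1.exists_linear_lower_bound {f : ℝ → ℝ} {μ' μ m : ℝ} (hf : H1 f μ' μ) (hm0 : 0 ≤ m)
    (hm : m < μ) : ∃ c > 0, ∃ δ > 0, ∀ s, m ≤ s → s < m + δ → c * (s - m) ≤ f s := by
  obtain ⟨hlip, -, -, hpos, -, -, h0⟩ := hf
  by_cases hfm : 0 < f m
  · have hev := (hlip.continuousWithinAt hm0).eventually (lt_mem_nhds (half_lt_self hfm))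
    obtain ⟨ε, hε, h⟩ := Metric.mem_nhdsWithin_iff.1 hev
    refine ⟨f m / 2, by positivity, min ε 1, by positivity, fun s hs hs' => ?_⟩
    have h1 : s < m + ε := hs'.trans_le (by gcongr; exact min_le_left _ _)
    have h2 : s < m + 1 := hs'.trans_le (by gcongr; exact min_le_right _ _)
    have h3 : f m / 2 < f s := h ⟨by
      rw [Metric.mem_ball, Real.dist_eq, abs_lt]; constructor <;> linarith, hm0.trans hs⟩
    nlinarith
  · obtain rfl : m = 0 := by
      by_contra hne
      exact hfm (hpos m (hm0.lt_of_ne' hne) hm)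
    obtain ⟨hf0, c, hc, hev⟩ := h0.resolve_left hfm
    obtain ⟨ε, hε, h⟩ := Metric.mem_nhdsWithin_iff.1 hev
    refine ⟨c, hc, ε, hε, fun s hs hs' => ?_⟩
    rcases hs.eq_or_lt with rfl | hs0
    · simp [hf0]
    have h1 : c ≤ f s / s := h ⟨by
      rw [Metric.mem_ball, Real.dist_eq, abs_lt]; constructor <;> linarith, hs0⟩
    rw [sub_zero]
    exact (le_div_iff₀ hs0).1 h1

theorem H3.exists_linear_upper_bound {f : ℝ → ℝ} {μ' μ M : ℝ} (hf : H1 f μ' μ) (hf3 : H3 f μ)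
    (hM : μ < M) :
    ∃ c > 0, ∃ δ > 0, ∀ s, 0 ≤ s → s ≤ M → M - δ < s → f s ≤ -c * (M - s) := by
  obtain ⟨hlip, hμ', hμμ, -, hnonpos, -, -⟩ := hf
  rcases (hnonpos M hM.le).eq_or_lt with hfM | hfM
  · obtain ⟨c, hc, hev⟩ := hf3 M hM hfM
    obtain ⟨ε, hε, h⟩ := Metric.mem_nhdsWithin_iff.1 hev
    refine ⟨c, hc, ε, hε, fun s _ hs hs' => ?_⟩
    rcases hs.eq_or_lt with rfl | hsM
    · simp [hfM]
    have h1 : c ≤ f s / (s - M) := h ⟨by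
      rw [Metric.mem_ball, Real.dist_eq, abs_lt]; constructor <;> linarith, hsM⟩
    rw [le_div_iff_of_neg (by linarith)] at h1
    linarith
  · have hev := (hlip.continuousWithinAt (s := M) (by linarith)).eventually
      (gt_mem_nhds (show f M < f M / 2 by linarith))
    obtain ⟨ε, hε, h⟩ := Metric.mem_nhdsWithin_iff.1 hev
    refine ⟨-f M / 2, by linarith, min ε 1, by positivity, fun s hs0 hs hs' => ?_⟩
    have h1 : M - ε < s := lt_of_le_of_lt (by gcongr; exact min_le_left _ _) hs'
    have h2 : M - 1 < s := lt_of_le_of_lt (by gcongr; exact min_le_right _ _) hs'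
    have h3 : f s < f M / 2 := h ⟨by
      rw [Metric.mem_ball, Real.dist_eq, abs_lt]; constructor <;> linarith, hs0⟩
    nlinarith

/-- Theorem 2.7 (Liouville theorem under (H1) and (H3)): every bounded nonnegative `C²`
solution of `Δu + f(u) = 0` in `ℝ^N` is constant. -/
theorem stmt_7
    {N : ℕ} (hN : 1 ≤ N) (f : ℝ → ℝ) (μ' μ : ℝ) (hf : H1 f μ' μ) (hf3 : H3 f μ)
    (u : (Fin N → ℝ) → ℝ)
    (hu_smooth : ContDiff ℝ 2 u)
    (hu_nonneg : ∀ x, 0 ≤ u x)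
    (hu_bdd : ∃ C, ∀ x, u x ≤ C)
    (hu_pde : ∀ x, lap u x + f (u x) = 0) :
    ∃ c : ℝ, ∀ x, u x = c := by
  obtain ⟨C, hC⟩ := hu_bdd
  have hbelow : BddBelow (range u) := ⟨0, by rintro _ ⟨x, rfl⟩; exact hu_nonneg x⟩
  have habove : BddAbove (range u) := ⟨C, by rintro _ ⟨x, rfl⟩; exact hC x⟩
  have hm (x) : ⨅ x, u x ≤ u x := ciInf_le hbelow x
  have hM (x) : u x ≤ ⨆ x, u x := le_ciSup habove x
  have hm0 : 0 ≤ ⨅ x, u x := le_ciInf hu_nonneg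
  generalize hm_def : ⨅ x, u x = m at hm hm0
  generalize hM_def : ⨆ x, u x = M at hM
  rcases lt_or_ge m μ with hmμ | hmμ
  · obtain ⟨c, hc, δ, hδ, hlow⟩ := hf.exists_linear_lower_bound hm0 hmμ
    rcases eq_zero_or_le_of_lap_le (w := fun x => u x - m) hc hδ (hu_smooth.sub contDiff_const)
      (fun x => sub_nonneg.2 (hm x)) (fun x hx => by
        have := hlow (u x) (hm x) (by linarith)
        rw [lap_sub_const]
        linarith [hu_pde x]) with h | h
    · exact ⟨m, fun x => sub_eq_zero.1 (h x)⟩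
    · have : m + δ ≤ ⨅ x, u x := le_ciInf fun x => by linarith [h x]
      linarith
  rcases lt_or_ge μ M with hMμ | hMμ
  · obtain ⟨c, hc, δ, hδ, hup⟩ := hf3.exists_linear_upper_bound hf hMμ
    rcases eq_zero_or_le_of_lap_le (w := fun x => M - u x) hc hδ (contDiff_const.sub hu_smooth)
      (fun x => sub_nonneg.2 (hM x)) (fun x hx => by
        have := hup (u x) (hu_nonneg x) (hM x) (by linarith)
        rw [lap_const_sub]
        linarith [hu_pde x]) with h | h
    · exact ⟨M, fun x => (sub_eq_zero.1 (h x)).symm⟩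
    · have : ⨆ x, u x ≤ M - δ := ciSup_le fun x => by linarith [h x]
      linarith
  exact ⟨μ, fun x => le_antisymm ((hM x).trans hMμ) (hmμ.trans (hm x))⟩
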